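/- Let (Q,·,\,1) be a uniquely 2-divisible commutative automorphic loop and let a ∈ Q satisfy P_a(P_x(y)) = P_x(P_a(y)) for all x,y ∈ Q (i.e., a lies in the center of the associated Bruck loop). Then a·x = a∘x for all x; equivalently, (a·x)·(a·x) = a⁻¹ \ ( a·(x·x) ) for all x ∈ Q. Moreover, defining left powers by a^0 := 1 and a^{n+1} := a·a^n, one has a^n·x = L_a^n(x) (the n-fold application of left translation by a) for all n ≥ 0 and all x ∈ Q. -/

import Mathlib

/-- Commutative automorphic loops: commutative loops whose inner mappings
`z ↦ (y * x) \ (y * (x * z))` are multiplicative. -/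
class CommAutomorphicLoop (Q : Type*) extends Mul Q, One Q where
  ldiv : Q → Q → Q
  ldiv_mul : ∀ x y : Q, ldiv x (x * y) = y
  mul_ldiv : ∀ x y : Q, x * ldiv x y = y
  one_mul' : ∀ x : Q, 1 * x = x
  mul_one' : ∀ x : Q, x * 1 = x
  mul_comm' : ∀ x y : Q, x * y = y * x
  inner_mul' : ∀ x y u v : Q,
    ldiv (y * x) (y * (x * (u * v))) =
      ldiv (y * x) (y * (x * u)) * ldiv (y * x) (y * (x * v))

namespace CommAutomorphicLoop

variable {Q : Type*} [CommAutomorphicLoop Q]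

attribute [simp] ldiv_mul mul_ldiv one_mul' mul_one'

theorem left_cancel {x y z : Q} (h : x * y = x * z) : y = z := by
  rw [← ldiv_mul x y, h, ldiv_mul]

theorem ldiv_eq {x y z : Q} (h : x * z = y) : ldiv x y = z := by
  rw [← h, ldiv_mul]

/-- The two-sided inverse. -/
def inv (x : Q) : Q := ldiv x 1

@[simp] theorem mul_inv (x : Q) : x * inv x = 1 := mul_ldiv x 1

@[simp] theorem inv_mul (x : Q) : inv x * x = 1 := by rw [mul_comm', mul_inv]

theorem inv_eq {x y : Q} (h : x * y = 1) : inv x = y := ldiv_eq h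

@[simp] theorem inv_inv (x : Q) : inv (inv x) = x := inv_eq (inv_mul x)

/-- The inner mapping `L_{x,y}`. -/
def inner (x y z : Q) : Q := ldiv (y * x) (y * (x * z))

theorem mul_inner (x y z : Q) : y * x * inner x y z = y * (x * z) := mul_ldiv _ _

theorem inner_mul (x y u v : Q) : inner x y (u * v) = inner x y u * inner x y v :=
  inner_mul' x y u v

theorem inner_one (x y : Q) : inner x y 1 = 1 := ldiv_eq (by simp)

theorem inner_ldiv (x y u v : Q) :
    inner x y (ldiv u v) = ldiv (inner x y u) (inner x y v) :=
  (ldiv_eq (by rw [← inner_mul, mul_ldiv])).symm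

theorem inner_inv (x y u : Q) : inner x y (inv u) = inv (inner x y u) := by
  rw [inv, inner_ldiv, inner_one, inv]

theorem inner_left_surjective (x y : Q) : Function.Surjective (inner x y) := fun z =>
  ⟨ldiv x (ldiv y (y * x * z)), ldiv_eq (by simp)⟩

theorem inner_fixes_right (x y : Q) : inner x y y = y :=
  ldiv_eq (by rw [mul_comm' (y * x) y, mul_comm' y x])

theorem inner_fixes_inv_right (x y : Q) : inner x y (inv y) = inv y := by
  rw [inner_inv, inner_fixes_right]

theorem inner_inv_left (x y : Q) : inner x y (inv x) = ldiv (y * x) y := by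
  rw [inner, mul_inv, mul_one']

theorem inner_inv_self (x z : Q) : inner (inv x) x z = x * (inv x * z) :=
  ldiv_eq (by rw [mul_inv, one_mul'])

theorem mul_inv_mul_hom (x u v : Q) :
    x * (inv x * (u * v)) = x * (inv x * u) * (x * (inv x * v)) := by
  simp only [← inner_inv_self, inner_mul]

theorem inv_mul_left_comm (x z : Q) : inv x * (x * z) = x * (inv x * z) := by
  apply left_cancel (x := x)
  rw [mul_inv_mul_hom, inv_mul, mul_one']

theorem mul_self_mul (x y : Q) : x * (y * ldiv (inv y) x) = x * y * (x * y) := by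
  rw [← mul_inner, inner_ldiv, inner_inv_left, inner_fixes_right]
  congr 1
  exact ldiv_eq (by rw [mul_comm', mul_ldiv])

theorem mul_inv_mul_sq (y z : Q) : y * (inv y * (z * z)) = y * z * (inv y * z) := by
  have h := mul_self_mul (inv y * z) y
  rw [ldiv_mul, mul_comm' (inv y * z) y] at h
  rw [mul_inv_mul_hom, ← h, mul_comm']

/-- The automorphic inverse property. -/
theorem inv_mul_distrib (y z : Q) : inv (y * z) = inv y * inv z := by
  apply inv_eq
  obtain ⟨s, hs⟩ := inner_left_surjective z y z
  have h_sq : inv y * (z * z) = z * (inv y * s) := by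
    apply left_cancel (x := y)
    rw [mul_inv_mul_sq, ← mul_inner z y, inner_mul, inner_fixes_inv_right, hs]
  have h_inner : inner (inv y) z s = inner z (inv y) z := by
    apply left_cancel (x := z * inv y)
    rw [mul_inner, mul_comm' z (inv y), mul_inner, h_sq]
  have h_inv : z * (inv y * inv s) = inv y := by
    rw [← mul_inner, inner_inv, h_inner, ← inner_inv, mul_comm' z, mul_inner, mul_inv, mul_one']
  have h_fix : inner z y (inv y * inv s) = inv y * inv z := by
    rw [inner_mul, inner_fixes_inv_right, inner_inv, hs]
  rw [← h_fix, mul_inner, h_inv, mul_inv]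

theorem inner_inv_inv (x y z : Q) : inner (inv x) (inv y) z = inner x y z := by
  apply ldiv_eq
  have h := congrArg inv (mul_inner x y (inv z))
  simpa only [inv_mul_distrib, inner_inv, inv_inv] using h

/-- The map `P_x`. -/
def quad (x y : Q) : Q := ldiv (inv x) (x * y)

theorem inv_mul_quad (x y : Q) : inv x * quad x y = x * y := mul_ldiv _ _

theorem quad_inv_mul (x y : Q) : quad x (inv x * y) = x * y :=
  ldiv_eq (inv_mul_left_comm x y)

theorem quad_inv_quad (x y : Q) : quad (inv x) (quad x y) = y := by
  rw [quad, inv_mul_quad, inv_inv, ldiv_mul]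

/-- `P_{xy} = L_x P_y L_{x⁻¹}⁻¹`. -/
theorem quad_mul (x y u : Q) : quad (x * y) (inv x * u) = x * quad y u := by
  obtain ⟨v, rfl⟩ : ∃ v, u = inv y * v := ⟨_, (mul_ldiv (inv y) u).symm⟩
  apply ldiv_eq
  rw [quad_inv_mul, ← mul_inner y x, inv_mul_left_comm, ← inner_inv_inv, inv_mul_distrib,
    mul_inner]

theorem quad_mul_eq (a x w : Q) : quad (a * x) w = quad a (quad (inv a * x) (quad a w)) := by
  obtain ⟨u, rfl⟩ : ∃ u, w = inv a * u := ⟨_, (mul_ldiv (inv a) w).symm⟩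
  have h := quad_mul (inv a) x u
  rw [inv_inv] at h
  rw [quad_mul, quad_inv_mul, h, quad_inv_mul]

/-- If `P_a` commutes with all `P_x`, then `P_a²` commutes with all left translations. -/
theorem quad_quad_mul {a : Q} (ha : ∀ x y : Q, quad a (quad x y) = quad x (quad a y)) (x v : Q) :
    quad a (quad a (x * v)) = x * quad a (quad a v) := by
  have h := quad_mul_eq a x (inv x * quad a v)
  rw [← ha, mul_comm' a, mul_comm' (inv a), quad_mul, quad_mul, quad_inv_quad] at h
  exact h.symm

theorem quad_quad_one (a : Q) : quad a (quad a 1) = a * a * (a * a) := by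
  have h_one : quad a 1 = a * a := ldiv_eq (by simp [inv_mul_left_comm])
  have h_four : a * a * (a * a) = a * (a * (a * a)) := by
    have h := mul_inner a a (a * a)
    rwa [inner_mul, inner_fixes_right] at h
  rw [h_one]
  apply ldiv_eq
  rw [h_four, inv_mul_left_comm, mul_inv_mul_hom, mul_inv_mul_hom]
  simp

/-- If squaring is injective, then Bruck-central elements are central. -/
theorem mul_assoc_of_quad_comm (hsq : ∀ x y : Q, x * x = y * y → x = y) {a : Q}
    (ha : ∀ x y : Q, quad a (quad x y) = quad x (quad a y)) (x y : Q) :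
    y * x * a = y * (x * a) := by
  have h_mul (z : Q) : quad a (quad a z) = z * (a * a * (a * a)) := by
    rw [← quad_quad_one, ← quad_quad_mul ha, mul_one']
  have h_fix : inner x y (a * a * (a * a)) = a * a * (a * a) :=
    ldiv_eq (by rw [← h_mul, ← h_mul, quad_quad_mul ha])
  have h_fix_a : inner x y a = a := by
    apply hsq
    apply hsq
    rw [← inner_mul, ← inner_mul, h_fix]
  rw [← mul_inner, h_fix_a]

end CommAutomorphicLoop


/-- **Lemma 4.3.** In a uniquely 2-divisible commutative automorphic loop with
associated Bruck loop operation `x ∘ y := √(P_x(y·y))`, if `a` lies in the center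
of the associated Bruck loop (i.e. `P_a P_x = P_x P_a` for all `x`, where
`x⁻¹ := x \ 1` and `P_x(y) := x⁻¹ \ (x·y)`), then `a·x = a∘x` for all `x`, and the
left powers of `a` satisfy `a^n · x = L_a^n(x)` for all `n ≥ 0`. -/
theorem bruck_central_left_translation_eq_bruck_translation
    (Q : Type) (mul ld : Q → Q → Q) (one : Q)
    (hld1 : ∀ x y : Q, ld x (mul x y) = y)
    (hld2 : ∀ x y : Q, mul x (ld x y) = y)
    (hone1 : ∀ x : Q, mul one x = x)
    (hone2 : ∀ x : Q, mul x one = x)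
    (hcomm : ∀ x y : Q, mul x y = mul y x)
    (hauto : ∀ x y u v : Q,
      ld (mul y x) (mul y (mul x (mul u v))) =
        mul (ld (mul y x) (mul y (mul x u))) (ld (mul y x) (mul y (mul x v))))
    (sqrt : Q → Q)
    (hsqrt1 : ∀ x : Q, mul (sqrt x) (sqrt x) = x)
    (hsqrt2 : ∀ x : Q, sqrt (mul x x) = x)
    (a : Q)
    (ha : ∀ x y : Q, ld (ld a one) (mul a (ld (ld x one) (mul x y))) =
      ld (ld x one) (mul x (ld (ld a one) (mul a y))))
    (pw : ℕ → Q)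
    (hpw0 : pw 0 = one)
    (hpws : ∀ n : ℕ, pw (n + 1) = mul a (pw n)) :
    (∀ x : Q, mul a x = sqrt (ld (ld a one) (mul a (mul x x)))) ∧
    (∀ (n : ℕ) (x : Q), mul (pw n) x = (fun y : Q => mul a y)^[n] x) := by
 
  let inst : CommAutomorphicLoop Q :=
    { mul := mul, one := one, ldiv := ld, ldiv_mul := hld1, mul_ldiv := hld2,
      one_mul' := hone1, mul_one' := hone2, mul_comm' := hcomm, inner_mul' := hauto }
  have hsq (x y : Q) (h : mul x x = mul y y) : x = y := by
    rw [← hsqrt2 x, h, hsqrt2]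
  have h_assoc (x y : Q) : mul (mul y x) a = mul y (mul x a) :=
    CommAutomorphicLoop.mul_assoc_of_quad_comm hsq ha x y
  have h_left (x y : Q) : mul (mul a x) y = mul a (mul x y) := by
    rw [hcomm a x, hcomm (mul x a) y, ← h_assoc, hcomm a, hcomm x]
  refine ⟨fun x => ?_, fun n => ?_⟩
  · have h_inv (z : Q) : mul (ld a one) (mul a z) = z := by
      rw [hcomm (ld a one), h_left, hcomm z, ← h_left, hld2, hone1]
    have h_ld (z : Q) : ld (ld a one) z = mul a z := by
      rw [← hld1 (ld a one) (mul a z), h_inv]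
    have h_sq : mul a (mul a (mul x x)) = mul (mul a x) (mul a x) := by
      rw [h_left x, hcomm x (mul a x), h_left x]
    rw [h_ld, h_sq, hsqrt2]
  · induction n with
    | zero => intro x; rw [hpw0, hone1, Function.iterate_zero_apply]
    | succ n ih => intro x; rw [hpws, h_left, ih, Function.iterate_succ_apply']
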